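/- arXiv:1411.3364 — 3 statements merged into one kernel-verified Lean document; each statement's English description precedes it below -/
import Mathlib

section
/- Let m₊ = ⌈n(log n + log log n)⌉. Asymptotically almost surely, for every vertex v ∈ V and every colour w ∈ W, at most 10 of the edges e₁,…,e_{m₊} are incident to v and assigned colour w; in particular, for every m ≤ m₊, no vertex of D(n,m) is incident to more than 10 edges of the same colour. -/
open Filter

/-- The directed edges of the complete digraph on `Fin n`:
ordered pairs `(tail, head)` of distinct vertices. -/
abbrev DEdge (n : ℕ) := {e : Fin n × Fin n // e.1 ≠ e.2}

/-- `ε(n) = log log n / log n`. -/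
noncomputable def eps (n : ℕ) : ℝ := Real.log (Real.log n) / Real.log n

/-- The number of available colours: `⌊(1 + 50 ε) n⌋`. -/
noncomputable def numColours (n : ℕ) : ℕ := ⌊(1 + 50 * eps n) * n⌋₊

/-- The set of colours `W`. -/
abbrev Colour (n : ℕ) := Fin (numColours n)

/-- The sample space of the coloured random digraph process: a uniformly random
permutation of the edges (determining the random ordering `e₁, …, e_N`) together
with a uniformly random colouring of the edges. -/
abbrev SampleSpace (n : ℕ) := Equiv.Perm (DEdge n) × (DEdge n → Colour n)

/-- The (0-indexed) position of edge `e` in the random ordering determined by `ω`. -/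
noncomputable def edgePos {n : ℕ} (ω : SampleSpace n) (e : DEdge n) : ℕ :=
  ((Fintype.equivFin (DEdge n)) (ω.1 e)).val

/-- `e` is one of the first `m` edges of the process, i.e. an edge of `D(n,m)`. -/
def inProcess {n : ℕ} (ω : SampleSpace n) (m : ℕ) (e : DEdge n) : Prop :=
  edgePos ω e < m

/-- The probability of an event under the uniform measure on a finite sample space. -/
noncomputable def prob {Ω : Type*} [Fintype Ω] (p : Ω → Prop) : ℝ :=
  (Nat.card {ω : Ω // p ω} : ℝ) / (Fintype.card Ω : ℝ)

/-- Vertex `v` has in-degree zero in `D(n,m)`. -/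
def InDegreeZero {n : ℕ} (ω : SampleSpace n) (m : ℕ) (v : Fin n) : Prop :=
  ∀ e : DEdge n, inProcess ω m e → e.val.2 ≠ v

/-- The event `Z_m`: at most one vertex of `D(n,m)` has in-degree zero. -/
def ZEvent {n : ℕ} (ω : SampleSpace n) (m : ℕ) : Prop :=
  Set.Subsingleton {v : Fin n | InDegreeZero ω m v}

/-- `A` is the edge set of a spanning arborescence rooted at `u`: the root has no
in-edge, every other vertex has exactly one in-edge, and every vertex is reachable
from the root along edges of `A` (equivalently, for every vertex `v` there is
exactly one directed path from `u` to `v`). -/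
def IsSpanningArborescence {n : ℕ} (A : Set (DEdge n)) (u : Fin n) : Prop :=
  (∀ e ∈ A, (e : DEdge n).val.2 ≠ u) ∧
  (∀ v : Fin n, v ≠ u → ∃! e : DEdge n, e ∈ A ∧ e.val.2 = v) ∧
  (∀ v : Fin n, Relation.ReflTransGen (fun x y => ∃ e ∈ A, (e : DEdge n).val = (x, y)) u v)

/-- The event `A_m`: `D(n,m)` contains a spanning arborescence. -/
def AEvent {n : ℕ} (ω : SampleSpace n) (m : ℕ) : Prop :=
  ∃ (u : Fin n) (A : Set (DEdge n)), (∀ e ∈ A, inProcess ω m e) ∧ IsSpanningArborescence A u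

/-- The event `R_m`: `D(n,m)` contains a rainbow spanning arborescence. -/
def REvent {n : ℕ} (ω : SampleSpace n) (m : ℕ) : Prop :=
  ∃ (u : Fin n) (A : Set (DEdge n)), (∀ e ∈ A, inProcess ω m e) ∧
    IsSpanningArborescence A u ∧ Set.InjOn ω.2 A

/-- The hitting time `min {m : P m}`, with the convention `min ∅ = N = n(n-1)`. -/
noncomputable def hitTime (n : ℕ) (P : ℕ → Prop) : ℕ :=
  sInf ({m | P m} ∪ {n * (n - 1)})

open Finset in
/-- For a transitive action, the image of a fixed point under a uniform group element is uniform. -/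
theorem card_filter_smul_mem_mul_card {G X : Type*} [Group G] [Fintype G] [Fintype X]
    [DecidableEq X] [MulAction G X] [MulAction.IsPretransitive G X] (x : X) (Q : Finset X) :
    #{g : G | g • x ∈ Q} * Fintype.card X = #Q * Fintype.card G := by
  have key : ∀ R : Finset X, #{g : G | g • x ∈ R} = #R * #{g : G | g • x = x} := by
    intro R
    rw [card_eq_sum_card_fiberwise (f := fun g : G => g • x) (t := R)
      (fun g hg => by simpa using hg)]
    refine sum_const_nat fun y hy => ?_
    obtain ⟨h, rfl⟩ := MulAction.exists_smul_eq G x y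
    refine card_nbij' (fun g => h⁻¹ * g) (fun g => h * g) ?_ ?_ ?_ ?_
    · intro g hg
      have hg' : g • x = h • x := by simp_all
      simp [mul_smul, hg']
    · intro g hg
      have hg' : g • x = x := by simpa using hg
      simp [mul_smul, hg', hy]
    · intro g _; simp
    · intro g _; simp
  have huniv := key univ
  simp only [mem_univ, filter_true, card_univ] at huniv
  rw [key Q, huniv]
  ring

open Finset in
/-- A uniform permutation maps `k` given distinct points into `T` with probability at
most `(#T) ^ k / (#α)_k`. -/
theorem card_perm_maps_into_mul_descFactorial_le {α : Type*} [Fintype α] [DecidableEq α] {k : ℕ}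
    (a : Fin k ↪ α) (T : Finset α) :
    #{σ : Equiv.Perm α | ∀ i, σ (a i) ∈ T} * (Fintype.card α).descFactorial k
      ≤ #T ^ k * Fintype.card (Equiv.Perm α) := by
  classical
  have : MulAction.IsPretransitive (Equiv.Perm α) (Fin k ↪ α) :=
    Equiv.Perm.isMultiplyPretransitive α k
  have h := card_filter_smul_mem_mul_card (G := Equiv.Perm α) a
    {b : Fin k ↪ α | ∀ i, b i ∈ T}
  simp only [mem_filter_univ, Function.Embedding.smul_apply, Equiv.Perm.smul_def,
    Fintype.card_embedding_eq, Fintype.card_fin] at h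
  rw [h]
  gcongr
  calc #{b : Fin k ↪ α | ∀ i, b i ∈ T}
      ≤ #(Fintype.piFinset fun _ : Fin k => T) :=
        card_le_card_of_injOn (fun b => ⇑b) (by intro b hb; simpa using hb)
          DFunLike.coe_injective.injOn
    _ = #T ^ k := by simp

open Finset in
/-- A uniform colouring gives `k` fixed distinct points a fixed colour with probability
`(#β)⁻ᵏ`. -/
theorem card_monochromatic_mul_pow {α β : Type*} [Fintype α] [DecidableEq α] [Fintype β]
    [DecidableEq β] {k : ℕ} (a : Fin k ↪ α) (w : β) :
    #{f : α → β | ∀ i, f (a i) = w} * Fintype.card β ^ k = Fintype.card (α → β) := by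
  have hset : ({f : α → β | ∀ i, f (a i) = w} : Finset (α → β)) =
      Fintype.piFinset fun e => if e ∈ univ.map a then {w} else univ := by
    ext f
    simp only [mem_filter_univ, Fintype.mem_piFinset]
    constructor
    · intro h e
      split_ifs with he
      · obtain ⟨i, -, rfl⟩ := mem_map.1 he
        simp [h i]
      · simp
    · intro h i
      simpa using h (a i)
  have hcard : ∀ e, #(if e ∈ univ.map a then {w} else (univ : Finset β)) =
      if e ∈ univ.map a then 1 else Fintype.card β := fun e => by split_ifs <;> simp
  rw [hset, Fintype.card_piFinset, prod_congr rfl fun e _ => hcard e, prod_ite]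
  simp only [prod_const_one, one_mul, prod_const, Fintype.card_fun]
  rw [← pow_add]
  congr 1
  have h := card_filter_add_card_filter_not (s := (univ : Finset α)) (fun e => e ∈ univ.map a)
  rw [filter_mem_eq_inter, univ_inter, card_map, card_univ, card_univ, Fintype.card_fin] at h
  omega

theorem card_incident_le {n : ℕ} (v : Fin n) :
    Fintype.card {e : DEdge n // e.val.1 = v ∨ e.val.2 = v} ≤ 2 * n := by
  calc _ ≤ Fintype.card (Fin n ⊕ Fin n) := by
        refine Fintype.card_le_of_injective
          (fun e => if e.val.val.1 = v then Sum.inl e.val.val.2 else Sum.inr e.val.val.1) ?_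
        rintro ⟨⟨⟨x, y⟩, hxy⟩, h⟩ ⟨⟨⟨x', y'⟩, hxy'⟩, h'⟩ heq
        dsimp only at heq h h'
        split_ifs at heq <;> simp only [Sum.inl.injEq, Sum.inr.injEq] at heq <;> grind
    _ = 2 * n := by simp [two_mul]

theorem card_dedge (n : ℕ) : Fintype.card (DEdge n) = n * n - n := by
  have h := Fintype.card_subtype_compl (fun e : Fin n × Fin n => e.1 = e.2)
  have hd : Fintype.card {e : Fin n × Fin n // e.1 = e.2} = n := by
    refine (Fintype.card_congr ?_).trans (Fintype.card_fin n)
    exact ⟨fun e => e.val.1, fun x => ⟨(x, x), rfl⟩,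
      fun e => Subtype.ext (Prod.ext rfl e.prop), fun _ => rfl⟩
  rw [hd] at h
  simpa using h

/-- Some vertex is incident to `k` distinct edges of the same colour among the first `M`. -/
def HasMonochromaticStar {n : ℕ} (k M : ℕ) (ω : SampleSpace n) : Prop :=
  ∃ (v : Fin n) (w : Colour n) (a : Fin k ↪ {e : DEdge n // e.val.1 = v ∨ e.val.2 = v}),
    ∀ i, inProcess ω M (a i).val ∧ ω.2 (a i).val = w

theorem card_le_of_not_hasMonochromaticStar {n k M m : ℕ} (hm : m ≤ M) {ω : SampleSpace n}
    (h : ¬ HasMonochromaticStar (k + 1) M ω) (v : Fin n) (w : Colour n) :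
    Nat.card {e : DEdge n //
      inProcess ω m e ∧ (e.val.1 = v ∨ e.val.2 = v) ∧ ω.2 e = w} ≤ k := by
  classical
  by_contra! hlt
  rw [Nat.card_eq_fintype_card] at hlt
  obtain ⟨b⟩ := Function.Embedding.nonempty_of_card_le
    (α := Fin (k + 1)) (by simpa using Nat.succ_le_of_lt hlt)
  refine h ⟨v, w, ⟨fun i => ⟨(b i).val, (b i).prop.2.1⟩, fun i j hij => ?_⟩, fun i =>
    ⟨lt_of_lt_of_le (b i).prop.1 hm, (b i).prop.2.2⟩⟩
  exact b.injective (Subtype.ext (congrArg (fun e => e.val) hij))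

open Finset in
/-- First-moment bound for monochromatic stars. -/
theorem card_hasMonochromaticStar_le (n k M : ℕ) :
    Nat.card {ω : SampleSpace n // HasMonochromaticStar k M ω} *
        ((Fintype.card (DEdge n)).descFactorial k * numColours n ^ k)
      ≤ n * numColours n * (2 * n) ^ k * M ^ k * Fintype.card (SampleSpace n) := by
  classical
  let T : Finset (DEdge n) := {e | (Fintype.equivFin (DEdge n) e).val < M}
  have hT : #T ≤ M := by
    calc #T ≤ #(range M) := card_le_card_of_injOn (fun e => (Fintype.equivFin (DEdge n) e).val)
          (fun e he => by simpa [T] using he)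
          (fun x _ y _ h => (Fintype.equivFin (DEdge n)).injective (Fin.ext h))
      _ = M := card_range M
  let S (v : Fin n) (w : Colour n) (a : Fin k ↪ {e : DEdge n // e.val.1 = v ∨ e.val.2 = v}) :
      Finset (SampleSpace n) :=
    ({σ | ∀ i, σ (a i).val ∈ T} : Finset (Equiv.Perm (DEdge n))) ×ˢ
      ({f | ∀ i, f (a i).val = w} : Finset (DEdge n → Colour n))
  have hS : ∀ v w a, #(S v w a) * ((Fintype.card (DEdge n)).descFactorial k * numColours n ^ k)
      ≤ M ^ k * Fintype.card (SampleSpace n) := by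
    intro v w a
    have h1 := card_perm_maps_into_mul_descFactorial_le
      (a.trans (Function.Embedding.subtype _)) T
    have h2 := card_monochromatic_mul_pow (a.trans (Function.Embedding.subtype _)) w
    simp only [Function.Embedding.trans_apply, Function.Embedding.subtype_apply,
      Fintype.card_fin] at h1 h2
    rw [card_product, Fintype.card_prod, mul_mul_mul_comm, h2, ← mul_assoc]
    exact Nat.mul_le_mul_right _ (h1.trans (by gcongr))
  have hsub : ({ω | HasMonochromaticStar k M ω} : Finset (SampleSpace n)) ⊆
      univ.biUnion fun v => univ.biUnion fun w => univ.biUnion fun a => S v w a := by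
    intro ω hω
    obtain ⟨v, w, a, ha⟩ := (mem_filter_univ _).1 hω
    simp only [mem_biUnion, mem_univ, true_and]
    refine ⟨v, w, a, ?_⟩
    simp only [S, T, mem_product, mem_filter_univ]
    exact ⟨fun i => (ha i).1, fun i => (ha i).2⟩
  rw [Nat.card_eq_fintype_card, Fintype.card_subtype]
  set D := (Fintype.card (DEdge n)).descFactorial k * numColours n ^ k
  set B := M ^ k * Fintype.card (SampleSpace n)
  calc _ ≤ (∑ v : Fin n, ∑ w : Colour n, ∑ a, #(S v w a)) * D := by
        gcongr
        refine (card_le_card hsub).trans (card_biUnion_le.trans ?_)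
        refine sum_le_sum fun v _ => card_biUnion_le.trans ?_
        exact sum_le_sum fun w _ => card_biUnion_le
    _ = ∑ v : Fin n, ∑ w : Colour n, ∑ a, #(S v w a) * D := by simp only [sum_mul]
    _ ≤ ∑ v : Fin n, ∑ _w : Colour n,
          ∑ _a : Fin k ↪ {e : DEdge n // e.val.1 = v ∨ e.val.2 = v}, B := by
        gcongr with v _ w _ a _
        exact hS v w a
    _ ≤ ∑ _v : Fin n, ∑ _w : Colour n, (2 * n) ^ k * B := by
        gcongr with v _ w _
        rw [sum_const, smul_eq_mul, card_univ, Fintype.card_embedding_eq, Fintype.card_fin]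
        gcongr
        exact (Nat.descFactorial_le_pow _ _).trans (Nat.pow_le_pow_left (card_incident_le v) _)
    _ = n * numColours n * (2 * n) ^ k * M ^ k * Fintype.card (SampleSpace n) := by
        simp only [sum_const, card_univ, Fintype.card_fin, smul_eq_mul, B]
        ring

theorem prob_not_add_prob {Ω : Type*} [Fintype Ω] [Nonempty Ω] (p : Ω → Prop) :
    prob (fun ω => ¬ p ω) + prob p = 1 := by
  classical
  have h := Fintype.card_subtype_compl p
  have hle := Fintype.card_subtype_le p
  have hpos : (Fintype.card Ω : ℝ) ≠ 0 := by exact_mod_cast Fintype.card_ne_zero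
  rw [prob, prob, Nat.card_eq_fintype_card, Nat.card_eq_fintype_card, h, ← add_div,
    Nat.cast_sub hle, sub_add_cancel, div_self hpos]

theorem prob_mono {Ω : Type*} [Fintype Ω] {p q : Ω → Prop} (h : ∀ ω, p ω → q ω) :
    prob p ≤ prob q := by
  unfold prob
  gcongr
  exact Nat.card_le_card_of_injective _ (Subtype.map_injective h Function.injective_id)

theorem prob_le_one {Ω : Type*} [Fintype Ω] (p : Ω → Prop) : prob p ≤ 1 := by
  classical
  refine div_le_one_of_le₀ ?_ (by positivity)
  rw [Nat.card_eq_fintype_card]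
  exact_mod_cast Fintype.card_subtype_le p

theorem le_numColours {n : ℕ} (hn : 1 ≤ Real.log n) : n ≤ numColours n := by
  have heps : 0 ≤ eps n := div_nonneg (Real.log_nonneg hn) (by linarith)
  refine Nat.le_floor ?_
  nlinarith [mul_nonneg heps (Nat.cast_nonneg n (α := ℝ))]

theorem descFactorial_three_card_dedge_ge {n : ℕ} (hn : 4 ≤ n) :
    (n : ℝ) ^ 6 / 8 ≤ (Fintype.card (DEdge n)).descFactorial 3 := by
  have h : n * n ≤ 2 * (Fintype.card (DEdge n) + 1 - 3) := by
    rw [card_dedge]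
    have : 4 * n ≤ n * n := by gcongr
    omega
  have h' : (n : ℝ) * n ≤ 2 * ((Fintype.card (DEdge n) + 1 - 3 : ℕ) : ℝ) := by exact_mod_cast h
  calc (n : ℝ) ^ 6 / 8 = ((n : ℝ) * n / 2) ^ 3 := by ring
    _ ≤ ((Fintype.card (DEdge n) + 1 - 3 : ℕ) : ℝ) ^ 3 := by gcongr; linarith
    _ ≤ _ := by exact_mod_cast Nat.pow_sub_le_descFactorial _ 3

theorem prob_hasMonochromaticStar_three_le {n : ℕ} (hn : 4 ≤ n) (hlog : 1 ≤ Real.log n) :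
    prob (fun ω : SampleSpace n => HasMonochromaticStar 3
        ⌈(n : ℝ) * (Real.log n + Real.log (Real.log n))⌉₊ ω)
      ≤ 1728 * (Real.log n ^ 3 / n) := by
  set M := ⌈(n : ℝ) * (Real.log n + Real.log (Real.log n))⌉₊
  have hn0 : (0 : ℝ) < n := by positivity
  have hn1 : (1 : ℝ) ≤ n := by exact_mod_cast (by omega : 1 ≤ n)
  have hC : (n : ℝ) ≤ numColours n := by exact_mod_cast le_numColours hlog
  have hC0 : (0 : ℝ) < numColours n := hn0.trans_le hC
  have : Nonempty (Colour n) := ⟨⟨0, by exact_mod_cast hC0⟩⟩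
  have hM : (M : ℝ) ≤ 3 * n * Real.log n := by
    have hll : 0 ≤ Real.log (Real.log n) := Real.log_nonneg hlog
    have h1 := (Nat.ceil_lt_add_one (a := (n : ℝ) * (Real.log n + Real.log (Real.log n)))
      (by positivity)).le
    have h2 := Real.log_le_sub_one_of_pos (x := Real.log n) (by linarith)
    nlinarith [mul_le_mul_of_nonneg_left h2 hn0.le]
  have hD := descFactorial_three_card_dedge_ge hn
  have hbound : (Nat.card {ω : SampleSpace n // HasMonochromaticStar 3 M ω} : ℝ) *
        ((Fintype.card (DEdge n)).descFactorial 3 * numColours n ^ 3)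
      ≤ n * numColours n * (2 * n) ^ 3 * M ^ 3 * Fintype.card (SampleSpace n) := by
    exact_mod_cast card_hasMonochromaticStar_le n 3 M
  have hΩ : (0 : ℝ) < Fintype.card (SampleSpace n) := by exact_mod_cast Fintype.card_pos
  set D : ℝ := ((Fintype.card (DEdge n)).descFactorial 3 : ℝ)
  have hD0 : 0 < D := lt_of_lt_of_le (by positivity) hD
  set C : ℝ := (numColours n : ℝ)
  set P : ℝ := prob (fun ω : SampleSpace n => HasMonochromaticStar 3 M ω)
  have hP : P * (D * C ^ 3) ≤ n * C * (2 * n) ^ 3 * M ^ 3 := by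
    have : (Nat.card {ω : SampleSpace n // HasMonochromaticStar 3 M ω} : ℝ) =
        P * Fintype.card (SampleSpace n) := (div_mul_cancel₀ _ hΩ.ne').symm
    rw [this] at hbound
    refine le_of_mul_le_mul_right ?_ hΩ
    calc _ = _ := by ring
      _ ≤ _ := hbound
  calc P ≤ n * C * (2 * n) ^ 3 * M ^ 3 / (D * C ^ 3) := (le_div_iff₀ (by positivity)).2 hP
    _ = n * (2 * n) ^ 3 * M ^ 3 / (D * C ^ 2) := by field_simp
    _ ≤ n * (2 * n) ^ 3 * (3 * n * Real.log n) ^ 3 / ((n : ℝ) ^ 6 / 8 * n ^ 2) := by gcongr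
    _ = 1728 * (Real.log n ^ 3 / n) := by field_simp; norm_num

/-- With `m₊ = ⌈n (log n + log log n)⌉`, a.a.s. for every vertex `v`
and colour `w`, at most `10` of the first `m₊` edges are incident to `v` (as head or
tail) and have colour `w`; in particular, for every `m ≤ m₊` no vertex of `D(n,m)` is
incident to more than `10` edges of the same colour. -/
theorem aas_no_vertex_many_edges_same_colour :
    Tendsto
      (fun n : ℕ => prob (fun ω : SampleSpace n =>
        ∀ m ≤ ⌈(n : ℝ) * (Real.log n + Real.log (Real.log n))⌉₊,
          ∀ v : Fin n, ∀ w : Colour n,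
            Nat.card {e : DEdge n //
                inProcess ω m e ∧ (e.val.1 = v ∨ e.val.2 = v) ∧ ω.2 e = w} ≤ 10))
      atTop (nhds 1) := by
  let M (n : ℕ) : ℕ := ⌈(n : ℝ) * (Real.log n + Real.log (Real.log n))⌉₊
  have hlog : ∀ᶠ n : ℕ in atTop, 1 ≤ Real.log n :=
    (Real.tendsto_log_atTop.comp tendsto_natCast_atTop_atTop).eventually_ge_atTop 1
  have hlim : Tendsto (fun n : ℕ => 1 - 1728 * (Real.log n ^ 3 / n)) atTop (nhds 1) := by
    have h := (Real.isLittleO_pow_log_id_atTop (n := 3)).comp_tendsto tendsto_natCast_atTop_atTop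
    simpa using (h.tendsto_div_nhds_zero.const_mul 1728).const_sub 1
  refine tendsto_of_tendsto_of_tendsto_of_le_of_le' hlim tendsto_const_nhds ?_
    (Eventually.of_forall fun n => prob_le_one _)
  filter_upwards [hlog, eventually_ge_atTop 4] with n hn hn4
  have : Nonempty (Colour n) := ⟨⟨0, by have := le_numColours hn; omega⟩⟩
  have hbad := prob_hasMonochromaticStar_three_le hn4 hn
  have hsum := prob_not_add_prob (fun ω : SampleSpace n => HasMonochromaticStar 3 (M n) ω)
  refine (by linarith : _ ≤ prob (fun ω : SampleSpace n => ¬ HasMonochromaticStar 3 (M n) ω)).trans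
    (prob_mono fun ω hω m hm v w => ?_)
  exact (card_le_of_not_hasMonochromaticStar hm hω v w).trans (by norm_num)
end

section
/- Fix a partition of the colour set W into a set W_reg of ⌈(1+45ε)n⌉ regular colours and the remaining special colours, and let m₋ = ⌊n(log n − log log n)⌋. Asymptotically almost surely, the number of vertices v ∈ V whose in-degree in D(n, m₋), counting only edges with colour in W_reg, is at most 2, is at most (log n)^9. -/
open Filter

/-- The number of permutations mapping a set `S` into a set `T` is at most what it would be
if the images of the elements of `S` were independent. -/
theorem card_perm_mapsTo_le {α : Type*} [Fintype α] [DecidableEq α] (T S : Finset α) :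
    (Finset.univ.filter fun π : Equiv.Perm α => ∀ a ∈ S, π a ∈ T).card
        * Fintype.card α ^ S.card
      ≤ Fintype.card (Equiv.Perm α) * T.card ^ S.card := by
  induction S using Finset.induction_on with
  | empty => simp
  | insert a S ha ih =>
    let f : Finset α → Finset (Equiv.Perm α) := fun S =>
      Finset.univ.filter fun π : Equiv.Perm α => ∀ a ∈ S, π a ∈ T
    change (f (insert a S)).card * _ ≤ _
    change (f S).card * _ ≤ _ at ih
    have h_swap : ∀ b, (f (insert a S)).card ≤ (f (insert b S)).card := by
      intro b
      by_cases hb : b ∈ S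
      · refine Finset.card_le_card fun π hπ => ?_
        simp only [f, Finset.mem_filter, Finset.mem_univ, true_and] at hπ ⊢
        rw [Finset.insert_eq_of_mem hb]
        exact fun x hx => hπ x (Finset.mem_insert_of_mem hx)
      · refine Finset.card_le_card_of_injOn (fun π => π * Equiv.swap a b) ?_
          (fun _ _ _ _ h => mul_right_cancel h)
        intro π hπ
        simp only [f, Finset.coe_filter, Finset.mem_univ, true_and, Set.mem_ofPred_eq,
          Finset.mem_insert, forall_eq_or_imp, Equiv.Perm.mul_apply,
          Equiv.swap_apply_right] at hπ ⊢
        refine ⟨hπ.1, fun x hx => ?_⟩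
        rw [Equiv.swap_apply_of_ne_of_ne (by rintro rfl; exact ha hx)
          (by rintro rfl; exact hb hx)]
        exact hπ.2 x hx
    have h_sum : ∑ b, (f (insert b S)).card = (f S).card * T.card := by
      have h_fiber : ∀ π : Equiv.Perm α, (Finset.univ.filter fun b => π b ∈ T).card = T.card := by
        intro π
        rw [← Finset.card_map π.toEmbedding]
        congr 1
        ext x
        simp
      calc ∑ b, (f (insert b S)).card
          = ∑ b, ∑ π ∈ f S, if π b ∈ T then 1 else 0 := by
            refine Finset.sum_congr rfl fun b _ => ?_
            rw [← Finset.card_filter]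
            congr 1
            ext π
            simp [f, and_comm]
        _ = ∑ π ∈ f S, T.card := by
            rw [Finset.sum_comm]
            refine Finset.sum_congr rfl fun π _ => ?_
            rw [← Finset.card_filter, h_fiber]
        _ = _ := by simp
    have h_step : (f (insert a S)).card * Fintype.card α ≤ (f S).card * T.card := by
      rw [← h_sum, mul_comm, ← smul_eq_mul, ← Finset.card_univ, ← Finset.sum_const]
      exact Finset.sum_le_sum fun b _ => h_swap b
    rw [Finset.card_insert_of_notMem ha, pow_succ', pow_succ', ← mul_assoc]
    calc _ ≤ (f S).card * T.card * Fintype.card α ^ S.card := by gcongr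
      _ = (f S).card * Fintype.card α ^ S.card * T.card := by ring
      _ ≤ Fintype.card (Equiv.Perm α) * T.card ^ S.card * T.card := by gcongr
      _ = _ := by ring

/-- Exponential moment of a hypergeometric variable: it is dominated by the corresponding
binomial one. -/
theorem sum_perm_pow_card_le {α : Type*} [Fintype α] [DecidableEq α] [Nonempty α]
    (M F : Finset α) {t : ℝ} (ht0 : 0 ≤ t) (ht1 : t ≤ 1) :
    ∑ π : Equiv.Perm α, t ^ (F.filter fun a => π a ∈ M).card
      ≤ Fintype.card (Equiv.Perm α)
        * (1 - (1 - t) * (M.card / Fintype.card α)) ^ F.card := by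
  have hN : (0 : ℝ) < Fintype.card α := by exact_mod_cast Fintype.card_pos
  set r : ℝ := (Mᶜ.card : ℝ) / Fintype.card α with hr
  have h_r : 1 - (1 - t) * (M.card / Fintype.card α) = (1 - t) * r + t := by
    have : (M.card : ℝ) + Mᶜ.card = Fintype.card α := by exact_mod_cast M.card_add_card_compl
    rw [hr]
    field_simp
    linear_combination (t - 1) * this
  have h_expand : ∀ π : Equiv.Perm α, t ^ (F.filter fun a => π a ∈ M).card
      = ∑ S ∈ F.powerset, (1 - t) ^ S.card * t ^ (F.card - S.card)
          * (if ∀ a ∈ S, π a ∈ Mᶜ then 1 else 0) := by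
    intro π
    rw [Finset.card_filter, ← Finset.prod_pow_eq_pow_sum]
    have : ∀ a ∈ F, t ^ (if π a ∈ M then 1 else 0)
        = (1 - t) * (if π a ∈ Mᶜ then 1 else 0) + t := by
      intro a _
      by_cases h : π a ∈ M <;> simp [h]
    rw [Finset.prod_congr rfl this, Finset.prod_add]
    refine Finset.sum_congr rfl fun S hS => ?_
    rw [Finset.prod_mul_distrib, Finset.prod_const, Finset.prod_const,
      Finset.card_sdiff_of_subset (Finset.mem_powerset.1 hS), Finset.prod_ite_zero,
      Finset.prod_const_one]
    ring_nf
  have h_count : ∀ S : Finset α, ∑ π : Equiv.Perm α, (if ∀ a ∈ S, π a ∈ Mᶜ then (1 : ℝ) else 0)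
      ≤ Fintype.card (Equiv.Perm α) * r ^ S.card := by
    intro S
    rw [Finset.sum_boole, hr, div_pow, ← mul_div_assoc, le_div_iff₀ (by positivity)]
    exact_mod_cast card_perm_mapsTo_le Mᶜ S
  rw [h_r, Finset.sum_congr rfl fun π _ => h_expand π, Finset.sum_comm,
    ← Finset.sum_pow_mul_eq_add_pow, Finset.mul_sum]
  refine Finset.sum_le_sum fun S _ => ?_
  rw [← Finset.mul_sum]
  have h1t : 0 ≤ 1 - t := by linarith
  calc _ ≤ (1 - t) ^ S.card * t ^ (F.card - S.card)
        * (Fintype.card (Equiv.Perm α) * r ^ S.card) := by gcongr; exact h_count S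
    _ = _ := by rw [mul_pow]; ring

/-- Exponential moment of the number of elements of `G` coloured from `W`. -/
theorem sum_colouring_pow_card {α κ : Type*} [Fintype α] [DecidableEq α] [Fintype κ]
    [DecidableEq κ] [Nonempty κ] (G : Finset α) (W : Finset κ) (s : ℝ) :
    ∑ c : α → κ, s ^ (G.filter fun a => c a ∈ W).card
      = Fintype.card (α → κ) * (1 - (1 - s) * (W.card / Fintype.card κ)) ^ G.card := by
  have hC : (Fintype.card κ : ℝ) ≠ 0 := by exact_mod_cast Fintype.card_ne_zero
  set t : ℝ := 1 - (1 - s) * (W.card / Fintype.card κ) with ht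
  have h_prod : ∀ c : α → κ, s ^ (G.filter fun a => c a ∈ W).card
      = ∏ a, (if a ∈ G then (if c a ∈ W then s else 1) else 1) := by
    intro c
    rw [Finset.prod_ite_mem, Finset.univ_inter, ← Finset.prod_filter, Finset.prod_const]
  have h_sum : ∀ a, ∑ k : κ, (if a ∈ G then (if k ∈ W then s else 1) else 1)
      = Fintype.card κ * (if a ∈ G then t else 1) := by
    intro a
    by_cases ha : a ∈ G
    · have h_ite : ∀ k : κ, (if k ∈ W then s else 1) = 1 - (1 - s) * (if k ∈ W then 1 else 0) := by
        intro k
        split_ifs <;> ring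
      simp only [ha, if_true, h_ite, Finset.sum_sub_distrib, ← Finset.mul_sum, ht]
      simp
      field_simp
    · simp [ha]
  rw [Finset.sum_congr rfl fun c _ => h_prod c,
    ← Fintype.prod_sum (fun (a : α) (k : κ) => if a ∈ G then (if k ∈ W then s else 1) else 1),
    Finset.prod_congr rfl fun a _ => h_sum a, Finset.prod_mul_distrib, Finset.prod_ite_mem]
  simp

/-- Exponential moment of the number of elements of `F` that a random permutation sends to `M`
and a random colouring colours from `W`. -/
theorem sum_perm_colouring_pow_card_le {α κ : Type*} [Fintype α] [DecidableEq α] [Nonempty α]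
    [Fintype κ] [DecidableEq κ] [Nonempty κ] (M F : Finset α) (W : Finset κ) {s : ℝ}
    (hs0 : 0 ≤ s) (hs1 : s ≤ 1) :
    ∑ ω : Equiv.Perm α × (α → κ), s ^ (F.filter fun a => ω.1 a ∈ M ∧ ω.2 a ∈ W).card
      ≤ Fintype.card (Equiv.Perm α × (α → κ)) *
        Real.exp (-((1 - s) * (W.card / Fintype.card κ)
          * (F.card * M.card / Fintype.card α))) := by
  have hq0 : (0 : ℝ) ≤ W.card / Fintype.card κ := by positivity
  have hq1 : (W.card : ℝ) / Fintype.card κ ≤ 1 :=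
    div_le_one_of_le₀ (by exact_mod_cast W.card_le_univ) (by positivity)
  have hp0 : (0 : ℝ) ≤ M.card / Fintype.card α := by positivity
  have hp1 : (M.card : ℝ) / Fintype.card α ≤ 1 :=
    div_le_one_of_le₀ (by exact_mod_cast M.card_le_univ) (by positivity)
  rw [mul_div_assoc (F.card : ℝ)]
  have h_perm := fun t : ℝ => sum_perm_pow_card_le M F (t := t)
  generalize hq : (W.card : ℝ) / Fintype.card κ = q at *
  generalize (M.card : ℝ) / Fintype.card α = p at *
  have ht0 : 0 ≤ (1 - s) * q := mul_nonneg (by linarith) hq0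
  have ht1 : (1 - s) * q ≤ 1 := mul_le_one₀ (by linarith) hq0 hq1
  calc _ = ∑ π : Equiv.Perm α, (Fintype.card (α → κ) : ℝ)
        * (1 - (1 - s) * q) ^ (F.filter fun a => π a ∈ M).card := by
        rw [Fintype.sum_prod_type]
        refine Finset.sum_congr rfl fun π _ => ?_
        simp only [← Finset.filter_filter]
        rw [sum_colouring_pow_card, hq]
    _ ≤ Fintype.card (α → κ) * (Fintype.card (Equiv.Perm α)
        * (1 - (1 - (1 - (1 - s) * q)) * p) ^ F.card) := by
        rw [← Finset.mul_sum]
        gcongr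
        exact h_perm _ (by linarith) (by linarith)
    _ = Fintype.card (Equiv.Perm α × (α → κ)) * (1 - (1 - s) * q * p) ^ F.card := by
        rw [Fintype.card_prod, sub_sub_cancel]
        push_cast
        ring
    _ ≤ Fintype.card (Equiv.Perm α × (α → κ)) * Real.exp (-((1 - s) * q * p)) ^ F.card := by
        have : (1 - s) * q * p ≤ 1 := mul_le_one₀ ht1 hp0 hp1
        exact mul_le_mul_of_nonneg_left
          (pow_le_pow_left₀ (by linarith) (Real.one_sub_le_exp_neg _) _) (by positivity)
    _ = _ := by
        rw [← Real.exp_nat_mul]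
        ring_nf

/-- Markov's inequality for the number of indices `v` at which `X ω v ≤ k`, in terms of
exponential moments. -/
theorem one_sub_le_prob_ncard_le {Ω V : Type*} [Fintype Ω] [Nonempty Ω] [Fintype V]
    (X : Ω → V → ℕ) (k : ℕ) {s K B : ℝ} (hs0 : 0 < s) (hs1 : s ≤ 1) (hK : 0 < K)
    (hB : ∀ v, ∑ ω, s ^ X ω v ≤ Fintype.card Ω * B) :
    1 - Fintype.card V * B / (s ^ k * K)
      ≤ prob fun ω => (({v | X ω v ≤ k}.ncard : ℕ) : ℝ) ≤ K := by
  classical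
  have hΩ : (0 : ℝ) < Fintype.card Ω := by exact_mod_cast Fintype.card_pos
  set p : Ω → Prop := fun ω => (({v | X ω v ≤ k}.ncard : ℕ) : ℝ) ≤ K with hp
  have h_add : ((Finset.univ.filter p).card : ℝ)
      + (Finset.univ.filter fun ω => ¬ p ω).card = Fintype.card Ω := by
    exact_mod_cast Finset.card_filter_add_card_filter_not p
  have h_point : ∀ ω, (if ¬ p ω then s ^ k * K else 0) ≤ ∑ v, s ^ X ω v := by
    intro ω
    split_ifs with h
    · positivity
    · rw [hp, not_le, Set.ncard_eq_toFinset_card'] at h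
      calc s ^ k * K ≤ s ^ k * ({v | X ω v ≤ k} : Set V).toFinset.card := by gcongr
        _ = ∑ v ∈ ({v | X ω v ≤ k} : Set V).toFinset, s ^ k := by simp [mul_comm]
        _ ≤ ∑ v ∈ ({v | X ω v ≤ k} : Set V).toFinset, s ^ X ω v :=
            Finset.sum_le_sum fun v hv =>
              pow_le_pow_of_le_one hs0.le hs1 (by simpa using hv)
        _ ≤ ∑ v, s ^ X ω v :=
            Finset.sum_le_sum_of_subset_of_nonneg (Finset.subset_univ _)
              fun _ _ _ => by positivity
  have h_bad : (Finset.univ.filter fun ω => ¬ p ω).card * (s ^ k * K)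
      ≤ Fintype.card V * (Fintype.card Ω * B) := by
    calc _ = ∑ ω, (if ¬ p ω then s ^ k * K else 0) := by
          rw [← Finset.sum_filter, Finset.sum_const, nsmul_eq_mul]
      _ ≤ ∑ ω, ∑ v, s ^ X ω v := Finset.sum_le_sum fun ω _ => h_point ω
      _ = ∑ v, ∑ ω, s ^ X ω v := Finset.sum_comm
      _ ≤ ∑ v : V, (Fintype.card Ω * B) := Finset.sum_le_sum fun v _ => hB v
      _ = _ := by simp
  have h_bad' : ((Finset.univ.filter fun ω => ¬ p ω).card : ℝ) / Fintype.card Ω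
      ≤ Fintype.card V * B / (s ^ k * K) := by
    rw [div_le_div_iff₀ hΩ (by positivity)]
    linarith
  have h_prob : prob p = (Finset.univ.filter p).card / Fintype.card Ω := by
    rw [prob, Nat.card_eq_fintype_card, Fintype.card_subtype]
  rw [h_prob, eq_sub_of_add_eq h_add, sub_div, div_self hΩ.ne']
  linarith

/-- A uniformly random permutation and colouring of the edges produce few vertices of small
in-degree in the colours `W`. -/
theorem one_sub_le_prob_inDegree {n : ℕ} (hn : 2 ≤ n) (hC : 0 < numColours n)
    (W : Set (Colour n)) (k : ℕ) {m : ℕ} (hm : m ≤ n * (n - 1)) {s K : ℝ} (hs0 : 0 < s)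
    (hs1 : s ≤ 1) (hK : 0 < K) :
    1 - n * Real.exp (-((1 - s) * (W.ncard / numColours n) * (m / n))) / (s ^ k * K)
      ≤ prob fun ω : SampleSpace n =>
        ({v : Fin n | Nat.card {e : DEdge n //
          inProcess ω m e ∧ e.val.2 = v ∧ ω.2 e ∈ W} ≤ k}.ncard : ℝ) ≤ K := by
  classical
  have h_fiber : ∀ v : Fin n,
      (Finset.univ.filter fun e : DEdge n => e.val.2 = v).card = n - 1 := by
    intro v
    have h := Finset.card_erase_of_mem (Finset.mem_univ v)
    rw [Finset.card_univ, Fintype.card_fin] at h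
    rw [← h]
    refine Finset.card_bij (fun e _ => e.val.1) ?_ ?_ ?_
    · rintro ⟨e, he⟩ h
      simp at h ⊢
      rwa [← h]
    · rintro ⟨⟨a, b⟩, he⟩ h ⟨⟨a', b'⟩, he'⟩ h' hh
      simp_all
    · intro u hu
      exact ⟨⟨(u, v), by simpa using hu⟩, by simp, rfl⟩
  have h_card : Fintype.card (DEdge n) = n * (n - 1) := by
    rw [← Finset.card_univ, Finset.card_eq_sum_card_fiberwise
      (f := fun e : DEdge n => e.val.2) (t := Finset.univ) (by simp)]
    simp [h_fiber]
  have : Nonempty (Colour n) := ⟨⟨0, hC⟩⟩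
  have : Nonempty (DEdge n) := by
    rw [← Fintype.card_pos_iff, h_card]
    exact Nat.mul_pos (by omega) (by omega)
  set M : Finset (DEdge n) := Finset.univ.filter fun e => (Fintype.equivFin _ e).val < m with hM
  have hM_card : M.card = m := by
    rw [hM, ← Finset.card_map (Fintype.equivFin (DEdge n)).toEmbedding]
    have : Finset.map (Fintype.equivFin (DEdge n)).toEmbedding M
        = Finset.univ.filter fun i : Fin (Fintype.card (DEdge n)) => i.val < m := by
      ext x
      simp [hM]
    rw [← hM, this, Fin.card_filter_val_lt, h_card, min_eq_right hm]
  have h := one_sub_le_prob_ncard_le (fun (ω : SampleSpace n) (v : Fin n) =>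
    Nat.card {e : DEdge n // inProcess ω m e ∧ e.val.2 = v ∧ ω.2 e ∈ W}) k
    (B := Real.exp (-((1 - s) * (W.ncard / numColours n) * (m / n)))) hs0 hs1 hK ?_
  · simpa using h
  intro v
  have h_sum := sum_perm_colouring_pow_card_le M
    (Finset.univ.filter fun e : DEdge n => e.val.2 = v) W.toFinset hs0.le hs1
  rw [h_fiber, hM_card, h_card, ← Set.ncard_eq_toFinset_card', Fintype.card_fin] at h_sum
  have h_ratio : ((n - 1 : ℕ) : ℝ) * m / ((n * (n - 1) : ℕ) : ℝ) = m / n := by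
    have h1 : ((n - 1 : ℕ) : ℝ) ≠ 0 := by exact_mod_cast (by omega : n - 1 ≠ 0)
    have h2 : (n : ℝ) ≠ 0 := by exact_mod_cast (by omega : n ≠ 0)
    rw [Nat.cast_mul]
    field_simp
  rw [h_ratio] at h_sum
  refine le_trans (le_of_eq ?_) h_sum
  refine Finset.sum_congr rfl fun ω _ => ?_
  congr 1
  rw [Nat.card_eq_fintype_card, Fintype.card_subtype, Finset.filter_filter]
  congr 1
  ext e
  rw [Finset.mem_filter, Finset.mem_filter]
  simp [hM, inProcess, edgePos]
  tauto

/-- The proportion of regular colours is at least `1 - 5 ε`. -/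
theorem one_sub_five_mul_le_ceil_div_floor {ε x : ℝ} (hε : 0 ≤ ε) (hx : 1 ≤ x) :
    1 - 5 * ε ≤ (⌈(1 + 45 * ε) * x⌉₊ : ℝ) / ⌊(1 + 50 * ε) * x⌋₊ := by
  have h_pos : 0 < ⌊(1 + 50 * ε) * x⌋₊ := Nat.floor_pos.2 (by nlinarith)
  rw [le_div_iff₀ (by exact_mod_cast h_pos)]
  have h_ceil := Nat.le_ceil ((1 + 45 * ε) * x)
  have h_floor := Nat.floor_le (a := (1 + 50 * ε) * x) (by positivity)
  rcases le_total (1 - 5 * ε) 0 with h | h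
  · exact (mul_nonpos_of_nonpos_of_nonneg h (by positivity)).trans (by positivity)
  · calc _ ≤ (1 - 5 * ε) * ((1 + 50 * ε) * x) := by gcongr
      _ ≤ (1 + 45 * ε) * x := by nlinarith [mul_nonneg (sq_nonneg ε) (by linarith : 0 ≤ x)]
      _ ≤ _ := h_ceil

/-- Fix, for each `n`, a set `Wreg n` of `⌈(1 + 45 ε) n⌉` regular
colours (the remaining colours being special).  With `m₋ = ⌊n (log n - log log n)⌋`,
a.a.s. at most `(log n)^9` vertices have in-degree at most `2` in `D(n, m₋)` counting
only edges with a regular colour. -/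
theorem aas_few_dangerous_vertices
    (Wreg : ∀ n : ℕ, Set (Colour n))
    (hWreg : ∀ᶠ n in atTop, (Wreg n).ncard = ⌈(1 + 45 * eps n) * n⌉₊) :
    Tendsto
      (fun n : ℕ => prob (fun ω : SampleSpace n =>
        (({v : Fin n |
            Nat.card {e : DEdge n //
              inProcess ω ⌊(n : ℝ) * (Real.log n - Real.log (Real.log n))⌋₊ e ∧
                e.val.2 = v ∧ ω.2 e ∈ Wreg n} ≤ 2}.ncard : ℝ)
          ≤ (Real.log n) ^ 9)))
      atTop (nhds 1) := by
  have h_log : Tendsto (fun n : ℕ => Real.log n) atTop atTop :=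
    Real.tendsto_log_atTop.comp tendsto_natCast_atTop_atTop
  have h_lim : Tendsto (fun n : ℕ => 1 - Real.exp 2 / Real.log n) atTop (nhds 1) := by
    simpa using (h_log.const_div_atTop (Real.exp 2)).const_sub 1
  refine tendsto_of_tendsto_of_tendsto_of_le_of_le' h_lim tendsto_const_nhds ?_ ?_
  · filter_upwards [hWreg, h_log.eventually_ge_atTop 1, eventually_ge_atTop 2] with n hW hL hn
    have hn1 : (1 : ℝ) ≤ n := by exact_mod_cast (by omega : 1 ≤ n)
    have hn0 : (0 : ℝ) < n := by linarith
    have hl := Real.log_nonneg hL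
    have h_eps : 0 ≤ eps n := by unfold eps; positivity
    have hC : 0 < numColours n := Nat.floor_pos.2 (by nlinarith)
    have h_le_self := Real.log_le_sub_one_of_pos hn0
    have hll := Real.log_le_sub_one_of_pos (by linarith : 0 < Real.log n)
    have h_epsL : eps n * Real.log n = Real.log (Real.log n) :=
      div_mul_cancel₀ _ (by linarith)
    have h_expL : Real.exp (Real.log n) = n := Real.exp_log hn0
    have h_expl : Real.exp (Real.log (Real.log n)) = Real.log n := Real.exp_log (by linarith)
    have h_floor := Nat.floor_le (a := (n : ℝ) * (Real.log n - Real.log (Real.log n)))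
      (mul_nonneg hn0.le (by linarith))
    have h_floor' := Nat.lt_floor_add_one ((n : ℝ) * (Real.log n - Real.log (Real.log n)))
    set m := ⌊(n : ℝ) * (Real.log n - Real.log (Real.log n))⌋₊
    set L := Real.log n
    set l := Real.log L
    have hL0 : 0 < L := by linarith
    have hm : m ≤ n * (n - 1) := by
      have : (m : ℝ) ≤ n * (n - 1 : ℕ) := by
        rw [Nat.cast_pred (by omega)]
        exact h_floor.trans (mul_le_mul_of_nonneg_left (by linarith) hn0.le)
      exact_mod_cast this
    have h_q : 1 - 5 * eps n ≤ ((Wreg n).ncard : ℝ) / numColours n := by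
      rw [hW]
      exact one_sub_five_mul_le_ceil_div_floor h_eps hn1
    have h_q1 : ((Wreg n).ncard : ℝ) / numColours n ≤ 1 := by
      refine div_le_one_of_le₀ ?_ (by positivity)
      have := Set.ncard_le_card (Wreg n)
      rw [Nat.card_eq_fintype_card, Fintype.card_fin] at this
      exact_mod_cast this
    have h_x1 : (m : ℝ) / n ≤ L := by
      rw [div_le_iff₀ hn0]
      nlinarith
    have h_x0 : L - l - 1 ≤ (m : ℝ) / n := by
      rw [le_div_iff₀ hn0]
      nlinarith
    have h_x : (0 : ℝ) ≤ m / n := by positivity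
    have h_prob := one_sub_le_prob_inDegree hn hC (Wreg n) 2 hm (s := L⁻¹) (K := L ^ 9)
      (by positivity) (inv_le_one_of_one_le₀ hL) (by positivity)
    refine le_trans ?_ h_prob
    generalize ((Wreg n).ncard : ℝ) / numColours n = q at *
    generalize (m : ℝ) / n = x at *
    have h_exponent : -((1 - L⁻¹) * q * x) ≤ 2 + 6 * l - L := by
      have h1 : x - 5 * l ≤ q * x := by nlinarith
      have h2 : q * x ≤ L := by nlinarith
      have h3 : L⁻¹ * (q * x) ≤ 1 := by
        rw [inv_mul_le_iff₀ hL0]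
        linarith
      linarith
    have h_exp : Real.exp (2 + 6 * l - L) = Real.exp 2 * L ^ 6 / n := by
      rw [Real.exp_sub, Real.exp_add, h_expL, mul_comm 6 l, Real.exp_mul, h_expl]
      norm_cast
    have h_bound : n * Real.exp (-((1 - L⁻¹) * q * x)) / (L⁻¹ ^ 2 * L ^ 9)
        ≤ Real.exp 2 / L := by
      calc _ ≤ n * Real.exp (2 + 6 * l - L) / (L⁻¹ ^ 2 * L ^ 9) := by gcongr
        _ = _ := by
          rw [h_exp]
          field_simp
    linarith
  · exact Eventually.of_forall fun n => div_le_one_of_le₀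
      (by
        rw [← Nat.card_eq_fintype_card]
        exact_mod_cast Nat.card_le_card_of_injective _ Subtype.val_injective)
      (by positivity)
end

section
/- Let E be a finite set with |E| = N ≥ 1, let 1 ≤ m ≤ N, set p = m/N, let μ_m be the uniform probability measure on the m-element subsets of E, and let μ_p be the probability measure on subsets of E under which each element of E is included independently with probability p. Suppose m = m(N) → ∞ and m(1 − p) → ∞ as N → ∞. Then for every sequence of families 𝒫 = 𝒫(N) of subsets of E, for all sufficiently large N: μ_m(𝒫) ≤ 5√m · μ_p(𝒫). -/
open Filter

/-- An upper Stirling bound with the sharp constant at `n = 1`. -/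
theorem factorial_le_exp_mul_sqrt_mul_pow {n : ℕ} (hn : 1 ≤ n) :
    (n.factorial : ℝ) ≤ Real.exp 1 * √n * (n / Real.exp 1) ^ n := by
  obtain ⟨k, rfl⟩ : ∃ k, n = k + 1 := ⟨n - 1, by omega⟩
  have h : Stirling.stirlingSeq (k + 1) ≤ Stirling.stirlingSeq 1 :=
    Stirling.stirlingSeq'_antitone (Nat.zero_le k)
  rw [Stirling.stirlingSeq_one, Stirling.stirlingSeq, div_le_iff₀ (by positivity)] at h
  refine h.trans_eq ?_
  rw [Real.sqrt_mul (by norm_num)]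
  field_simp

/-- The binomial distribution with mean `m` has mass at least `1 / (5 √m)` at `m`. -/
theorem one_le_five_mul_sqrt_mul_choose_mul_pow {m k : ℕ} (hm : 1 ≤ m) (hk : 1 ≤ k) :
    1 ≤ 5 * √(m : ℝ) * (((m + k).choose m : ℝ) *
      (((m : ℝ) / (m + k)) ^ m * ((k : ℝ) / (m + k)) ^ k)) := by
  have hm0 : (0 : ℝ) < m := by exact_mod_cast hm
  have hk0 : (0 : ℝ) < k := by exact_mod_cast hk
  have he : Real.exp 1 * Real.exp 1 * √(k : ℝ) ≤ 5 * √(2 * Real.pi * (m + k)) := by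
    have he2 : Real.exp 1 * Real.exp 1 ≤ 10 := by
      nlinarith [Real.exp_one_lt_d9, Real.exp_pos 1]
    have hs : 2 * √(k : ℝ) ≤ √(2 * Real.pi * (m + k)) := by
      apply Real.le_sqrt_of_sq_le
      rw [mul_pow, Real.sq_sqrt hk0.le]
      nlinarith [Real.pi_gt_three]
    nlinarith [Real.sqrt_nonneg (k : ℝ)]
  have hN := Stirling.le_factorial_stirling (m + k)
  push_cast at hN
  have key : (m.factorial : ℝ) * k.factorial * ((m : ℝ) + k) ^ (m + k)
      ≤ 5 * √(m : ℝ) * (m + k).factorial * ((m : ℝ) ^ m * (k : ℝ) ^ k) :=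
    calc (m.factorial : ℝ) * k.factorial * ((m : ℝ) + k) ^ (m + k)
        ≤ (Real.exp 1 * √m * (m / Real.exp 1) ^ m) * (Real.exp 1 * √k * (k / Real.exp 1) ^ k)
            * ((m : ℝ) + k) ^ (m + k) := by
          gcongr
          · exact factorial_le_exp_mul_sqrt_mul_pow hm
          · exact factorial_le_exp_mul_sqrt_mul_pow hk
      _ = (Real.exp 1 * Real.exp 1 * √(k : ℝ)) *
            (√m * (((m : ℝ) + k) / Real.exp 1) ^ (m + k) * ((m : ℝ) ^ m * (k : ℝ) ^ k)) := by
          simp only [div_pow, pow_add]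
          field_simp
      _ ≤ (5 * √(2 * Real.pi * (m + k))) *
            (√m * (((m : ℝ) + k) / Real.exp 1) ^ (m + k) * ((m : ℝ) ^ m * (k : ℝ) ^ k)) := by
          gcongr
      _ = 5 * √(m : ℝ) * (√(2 * Real.pi * (m + k)) * (((m : ℝ) + k) / Real.exp 1) ^ (m + k))
            * ((m : ℝ) ^ m * (k : ℝ) ^ k) := by ring
      _ ≤ _ := by gcongr
  have hc : 5 * √(m : ℝ) * (((m + k).choose m : ℝ) *
      (((m : ℝ) / (m + k)) ^ m * ((k : ℝ) / (m + k)) ^ k)) =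
      (5 * √(m : ℝ) * (m + k).factorial * ((m : ℝ) ^ m * (k : ℝ) ^ k)) /
        ((m.factorial : ℝ) * k.factorial * ((m : ℝ) + k) ^ (m + k)) := by
    rw [Nat.cast_add_choose, div_pow, div_pow, pow_add]
    field_simp
  rw [hc, one_le_div (by positivity)]
  exact key

/-- Transfer from the uniform model to the binomial model.
Let `E N` be a finite set with `|E N| = N`, let `1 ≤ m N ≤ N` and `p = m/N`.
If `m → ∞` and `m (1 - p) → ∞`, then for every sequence of families `P N` of
subsets of `E N` and all sufficiently large `N`, the probability that a uniformly
random `m`-subset of `E N` lies in `P N` is at most `5 √m` times the probability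
that a random subset including each element independently with probability `p`
lies in `P N`. -/
theorem uniform_le_binomial_transfer
    (E : ℕ → Type*) [∀ N, Fintype (E N)] (hE : ∀ N, Fintype.card (E N) = N)
    (m : ℕ → ℕ) (hm : ∀ N, 1 ≤ N → 1 ≤ m N ∧ m N ≤ N)
    (hm_inf : Tendsto m atTop atTop)
    (hmp_inf : Tendsto (fun N => (m N : ℝ) * (1 - (m N : ℝ) / N)) atTop atTop)
    (P : ∀ N, Set (Finset (E N))) :
    ∀ᶠ N in atTop,
      (Nat.card {S : Finset (E N) // S.card = m N ∧ S ∈ P N} : ℝ) / (N.choose (m N) : ℝ)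
        ≤ 5 * Real.sqrt (m N) *
          ∑ S : Finset (E N),
            Set.indicator (P N)
              (fun S => ((m N : ℝ) / N) ^ S.card * (1 - (m N : ℝ) / N) ^ (N - S.card)) S := by
  classical
  filter_upwards [hmp_inf.eventually_gt_atTop 0, eventually_ge_atTop 1] with N hpos hN1
  obtain ⟨hm1, hmN⟩ := hm N hN1
  have hN0 : (0 : ℝ) < N := by exact_mod_cast hN1
  have hlt : m N ≠ N := by
    intro h
    rw [h, div_self hN0.ne'] at hpos
    simp at hpos
  obtain ⟨k, hk⟩ := Nat.exists_eq_add_of_le hmN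
  have hk1 : 1 ≤ k := by omega
  have hNr : (N : ℝ) = m N + k := by exact_mod_cast hk
  have hq : 1 - (m N : ℝ) / N = k / N := by
    rw [eq_div_iff hN0.ne', sub_mul, div_mul_cancel₀ _ hN0.ne', hNr]
    ring
  set w : ℝ := ((m N : ℝ) / N) ^ m N * ((k : ℝ) / N) ^ k
  have hmass : 1 ≤ 5 * √(m N : ℝ) * ((N.choose (m N) : ℝ) * w) := by
    have h := one_le_five_mul_sqrt_mul_choose_mul_pow hm1 hk1
    rwa [← hk, ← hNr] at h
  rw [hq]
  set A : Finset (Finset (E N)) := {S | S.card = m N ∧ S ∈ P N}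
  have hcard : Nat.card {S : Finset (E N) // S.card = m N ∧ S ∈ P N} = A.card := by
    rw [Nat.card_eq_fintype_card, Fintype.card_subtype]
  have hsum : (A.card : ℝ) * w ≤ ∑ S : Finset (E N), Set.indicator (P N)
      (fun S => ((m N : ℝ) / N) ^ S.card * ((k : ℝ) / N) ^ (N - S.card)) S := by
    rw [← nsmul_eq_mul, ← Finset.sum_const]
    refine (Finset.sum_le_sum fun S hS => ?_).trans
      (Finset.sum_le_sum_of_subset_of_nonneg (Finset.subset_univ A) fun S _ _ =>
        Set.indicator_nonneg (fun _ _ => by positivity) S)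
    obtain ⟨hS1, hS2⟩ := (Finset.mem_filter.mp hS).2
    rw [Set.indicator_of_mem hS2, hS1, show N - m N = k by omega]
  have hch : (0 : ℝ) < N.choose (m N) := by exact_mod_cast Nat.choose_pos hmN
  rw [hcard, div_le_iff₀ hch]
  calc (A.card : ℝ) ≤ A.card * (5 * √(m N : ℝ) * ((N.choose (m N) : ℝ) * w)) :=
        le_mul_of_one_le_right (Nat.cast_nonneg _) hmass
    _ = 5 * √(m N : ℝ) * (A.card * w) * N.choose (m N) := by ring
    _ ≤ _ := by gcongr
end
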